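/- arXiv:1804.11133 — 2 statements merged into one kernel-verified Lean document; each statement's English description precedes it below -/
import Mathlib

section
/- For every integer n, the automorphisms B and T^n A T^{-n} of the free group F₃ commute in Aut(F₃): (T^n A T^{-n}) ∘ B = B ∘ (T^n A T^{-n}). -/
/-- The free group on three generators. -/
abbrev F₃ : Type := FreeGroup (Fin 3)

/-- The generators of `F₃`. -/
abbrev x (i : Fin 3) : F₃ := FreeGroup.of i

open scoped Pointwise

/-- An automorphism with `x₀ ↦ x₀²x₁` and `x₁ ↦ x₀x₁` preserves the subgroup `⟨x₀, x₁⟩`. -/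
lemma smul_closure_eq_of_apply_generators (T : MulAut F₃)
    (hT0 : T (x 0) = x 0 * x 0 * x 1) (hT1 : T (x 1) = x 0 * x 1) :
    T • Subgroup.closure {x 0, x 1} = Subgroup.closure {x 0, x 1} := by
  have h0 : x 0 ∈ Subgroup.closure {x 0, x 1} := Subgroup.subset_closure (by simp)
  have h1 : x 1 ∈ Subgroup.closure {x 0, x 1} := Subgroup.subset_closure (by simp)
  apply le_antisymm
  · rw [Subgroup.pointwise_smul_subset_iff, Subgroup.closure_le]
    rintro y (rfl | rfl) <;> rw [SetLike.mem_coe, Subgroup.mem_inv_pointwise_smul_iff,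
      MulAut.smul_def]
    · rw [hT0]
      exact mul_mem (mul_mem h0 h0) h1
    · rw [hT1]
      exact mul_mem h0 h1
  · rw [Subgroup.closure_le]
    rintro y (rfl | rfl)
    · have h : T (x 0 * (x 1)⁻¹) = x 0 := by
        simp only [map_mul, map_inv, hT0, hT1]
        group
      have hm := Subgroup.smul_mem_pointwise_smul _ T _ (mul_mem h0 (inv_mem h1))
      rwa [MulAut.smul_def, h] at hm
    · have h : T (x 1 * (x 0)⁻¹ * x 1) = x 1 := by
        simp only [map_mul, map_inv, hT0, hT1]
        group
      have hm := Subgroup.smul_mem_pointwise_smul _ T _ (mul_mem (mul_mem h1 (inv_mem h0)) h1)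
      rwa [MulAut.smul_def, h] at hm

/-- An automorphism fixing `x₀` and `x₁` fixes the subgroup `⟨x₀, x₁⟩` pointwise. -/
lemma apply_eq_self_of_mem_closure (φ : MulAut F₃) (h0 : φ (x 0) = x 0) (h1 : φ (x 1) = x 1)
    {g : F₃} (hg : g ∈ Subgroup.closure {x 0, x 1}) : φ g = g := by
  have h : Set.EqOn φ.toMonoidHom (MonoidHom.id F₃) {x 0, x 1} := by
    rintro y (rfl | rfl)
    exacts [h0, h1]
  exact MonoidHom.eqOn_closure h hg

/-- Let `T, A, B ∈ Aut(F₃)` be the automorphisms determined on the generators by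
`T : x₀ ↦ x₀²x₁, x₁ ↦ x₀x₁, x₂ ↦ x₂`, `A : x₀ ↦ x₀, x₁ ↦ x₁, x₂ ↦ x₀x₂` and
`B : x₀ ↦ x₀, x₁ ↦ x₁, x₂ ↦ x₂x₁`.  Then for every integer `n`, the automorphisms
`B` and `Tⁿ A T⁻ⁿ` commute in `Aut(F₃)`. -/
theorem B_commutes_with_conjugated_A (T A B : MulAut F₃)
    (hT0 : T (x 0) = x 0 * x 0 * x 1) (hT1 : T (x 1) = x 0 * x 1) (hT2 : T (x 2) = x 2)
    (hA0 : A (x 0) = x 0) (hA1 : A (x 1) = x 1) (hA2 : A (x 2) = x 0 * x 2)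
    (hB0 : B (x 0) = x 0) (hB1 : B (x 1) = x 1) (hB2 : B (x 2) = x 2 * x 1) :
    ∀ n : ℤ, (T ^ n * A * T ^ (-n)) * B = B * (T ^ n * A * T ^ (-n)) := by
  intro n
  have h0 : x 0 ∈ Subgroup.closure {x 0, x 1} := Subgroup.subset_closure (by simp)
  have h1 : x 1 ∈ Subgroup.closure {x 0, x 1} := Subgroup.subset_closure (by simp)
  have hTH (m : ℤ) {g : F₃} (hg : g ∈ Subgroup.closure {x 0, x 1}) :
      (T ^ m) g ∈ Subgroup.closure {x 0, x 1} := by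
    have hm : T ^ m ∈ MulAction.stabilizer (MulAut F₃) (Subgroup.closure {x 0, x 1}) :=
      zpow_mem (smul_closure_eq_of_apply_generators T hT0 hT1) m
    have hs := Subgroup.smul_mem_pointwise_smul _ (T ^ m) _ hg
    rwa [MulAction.mem_stabilizer_iff.mp hm] at hs
  have hT2' (m : ℤ) : (T ^ m) (x 2) = x 2 :=
    zpow_mem (show T ∈ MulAction.stabilizer (MulAut F₃) (x 2) from hT2) m
  have hC {g : F₃} (hg : g ∈ Subgroup.closure {x 0, x 1}) :
      (T ^ n * A * T ^ (-n)) g = g := by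
    rw [MulAut.mul_apply, MulAut.mul_apply,
      apply_eq_self_of_mem_closure A hA0 hA1 (hTH _ hg), ← MulAut.mul_apply, ← zpow_add,
      add_neg_cancel, zpow_zero, MulAut.one_apply]
  have hC2 : (T ^ n * A * T ^ (-n)) (x 2) = (T ^ n) (x 0) * x 2 := by
    rw [MulAut.mul_apply, MulAut.mul_apply, hT2', hA2, map_mul, hT2']
  generalize T ^ n * A * T ^ (-n) = C at hC hC2 ⊢
  apply MulEquiv.toMonoidHom_injective
  ext i
  change C (B (x i)) = B (C (x i))
  fin_cases i
  · change C (B (x 0)) = B (C (x 0))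
    rw [hB0, hC h0, hB0]
  · change C (B (x 1)) = B (C (x 1))
    rw [hB1, hC h1, hB1]
  · change C (B (x 2)) = B (C (x 2))
    rw [hB2, map_mul, hC2, hC h1, map_mul, hB2,
      apply_eq_self_of_mem_closure B hB0 hB1 (hTH n h0), mul_assoc]
end

section
/- Let G be a connected simple graph on a vertex set V. Suppose that for every vertex w there are a set A_w and a map π_w : V → A_w such that: (1) π_w is injective on the set of neighbors of w (distinct neighbors of w have distinct images under π_w); (2) no two neighbors of w are adjacent to each other; (3) whenever x and y are adjacent vertices, both distinct from w and both not adjacent to w, then π_w(x) = π_w(y); and (4) whenever x is distinct from and not adjacent to w, and y is adjacent to both w and x, then π_w(x) = π_w(y). Then G contains no cycles; in particular, G is a tree. -/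
/-- If `f` agrees on adjacent vertices distinct from `w`, then every walk to `w` from another
vertex `v` uses an edge `s(x, w)` with `f v = f x`. -/
theorem SimpleGraph.Walk.exists_mk_mem_edges_eq {V A : Type*} {G : SimpleGraph V} {w : V}
    {f : V → A} (hf : ∀ x y, G.Adj x y → x ≠ w → y ≠ w → f x = f y) {v : V} (p : G.Walk v w)
    (hv : v ≠ w) : ∃ x, s(x, w) ∈ p.edges ∧ f v = f x := by
  induction p with
  | nil => exact absurd rfl hv
  | @cons v u w h q ih =>
    by_cases hu : u = w
    · subst hu
      exact ⟨v, by simp, rfl⟩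
    · obtain ⟨x, hx, hux⟩ := ih hf hu
      exact ⟨x, by simp [hx], (hf v u h hv hu).trans hux⟩

/-- Let `G` be a connected simple graph on a vertex set `V`.  Suppose that for every
vertex `w` there are a set `A_w` and a map `π_w : V → A_w` such that:
(1) `π_w` is injective on the neighbors of `w`;
(2) no two neighbors of `w` are adjacent to each other;
(3) whenever `x` and `y` are adjacent vertices, both distinct from `w` and both not
    adjacent to `w`, then `π_w x = π_w y`;
(4) whenever `x` is distinct from and not adjacent to `w`, and `y` is adjacent to both
    `w` and `x`, then `π_w x = π_w y`.
Then `G` contains no cycles; in particular, `G` is a tree. -/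
theorem tree_criterion_via_projections {V : Type*} (G : SimpleGraph V)
    (hconn : G.Connected)
    (hproj : ∀ w : V, ∃ (A : Type) (π : V → A),
      (∀ x y : V, G.Adj w x → G.Adj w y → π x = π y → x = y) ∧
      (∀ x y : V, G.Adj w x → G.Adj w y → ¬ G.Adj x y) ∧
      (∀ x y : V, G.Adj x y → x ≠ w → y ≠ w → ¬ G.Adj w x → ¬ G.Adj w y → π x = π y) ∧
      (∀ x y : V, x ≠ w → ¬ G.Adj w x → G.Adj w y → G.Adj x y → π x = π y)) :
    G.IsAcyclic ∧ G.IsTree := by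
  suffices h : G.IsAcyclic from ⟨h, hconn, h⟩
  intro w c hc
  obtain ⟨A, π, hinj, hindep, hfar, hnear⟩ := hproj w
  have hπ : ∀ x y, G.Adj x y → x ≠ w → y ≠ w → π x = π y := by
    intro x y hxy hx hy
    by_cases hwx : G.Adj w x
    · exact (hnear y x hy (fun hwy ↦ hindep x y hwx hwy hxy) hwx hxy.symm).symm
    · by_cases hwy : G.Adj w y
      · exact hnear x y hx hwx hwy hxy
      · exact hfar x y hxy hx hy hwx hwy
  cases c with
  | nil => exact hc.ne_nil rfl
  | @cons _ v _ h p =>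
    obtain ⟨x, hx, hvx⟩ := p.exists_mk_mem_edges_eq hπ h.ne'
    obtain rfl := hinj v x h (p.adj_of_mem_edges hx).symm hvx
    exact ((SimpleGraph.Walk.cons_isCycle_iff p h).1 hc).2 (Sym2.eq_swap ▸ hx)
end
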